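/- Under hypotheses (H1)–(H3), the fixed point φ = (x(·), y(·)) of the Lyapunov–Perron map 𝒯(·, x₀, t₀) satisfies the initial value problem ẋ = A(t)x + F(t,x,y) with x(t₀) = x₀, and ẏ = B(t)y + G(t,x,y) with y(t₀) = −∫_{t₀}^{∞} Λ_B(t₀,s) G(φ(s)) ds; moreover e^{−σ(t−t₀)}‖y(t)‖ → 0 as t → ∞, so in particular y remains bounded in the weighted norm. -/

import Mathlib

open MeasureTheory

open Filter Topology Set

/-- A norm-continuous two-parameter family of operators that solves `u' = A(t) u` strongly in its
first variable and is the identity on the diagonal. -/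
structure IsEvolutionFamily {E : Type*} [NormedAddCommGroup E] [NormedSpace ℝ E]
    (Λ : ℝ → ℝ → E →L[ℝ] E) (A : ℝ → E →L[ℝ] E) : Prop where
  continuous : Continuous fun p : ℝ × ℝ => Λ p.1 p.2
  apply_self : ∀ s ξ, Λ s s ξ = ξ
  hasDerivAt : ∀ s ξ t, HasDerivAt (fun τ => Λ τ s ξ) (A t (Λ t s ξ)) t

section Evolution

variable {E : Type*} [NormedAddCommGroup E] [NormedSpace ℝ E]

/-- Product rule for operators that are only strongly differentiable at `t`. -/
theorem HasDerivAt.clm_apply_of_continuousAt {W : ℝ → E →L[ℝ] E} {u : ℝ → E} {t : ℝ} {d u' : E}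
    (hW : ContinuousAt W t) (hd : HasDerivAt (fun τ => W τ (u t)) d t) (hu : HasDerivAt u u' t) :
    HasDerivAt (fun τ => W τ (u τ)) (W t u' + d) t := by
  rw [hasDerivAt_iff_tendsto_slope] at *
  have h : Tendsto (fun τ => W τ (slope u t τ) + slope (fun τ => W τ (u t)) t τ)
      (𝓝[≠] t) (𝓝 (W t u' + d)) :=
    ((isBoundedBilinearMap_apply.continuous.tendsto (W t, u')).comp
      ((hW.tendsto.mono_left nhdsWithin_le_nhds).prodMk_nhds hu)).add hd
  refine h.congr fun τ => ?_
  simp only [slope, vsub_eq_sub, map_smul, map_sub, ← smul_add]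
  congr 1
  abel

namespace IsEvolutionFamily

variable {Λ : ℝ → ℝ → E →L[ℝ] E} {A : ℝ → E →L[ℝ] E}

theorem continuous_fst (h : IsEvolutionFamily Λ A) (s : ℝ) : Continuous fun t => Λ t s :=
  h.continuous.comp (continuous_id.prodMk continuous_const)

theorem continuous_apply (h : IsEvolutionFamily Λ A) {f : ℝ → E} (hf : Continuous f) (t : ℝ) :
    Continuous fun s => Λ t s (f s) :=
  (h.continuous.comp (continuous_const.prodMk continuous_id)).clm_apply hf

/-- Near `s`, every solution of `u' = A(t) u` is `t ↦ Λ t s (u s)`. -/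
theorem eventually_eq_apply [CompleteSpace E] (h : IsEvolutionFamily Λ A) {u : ℝ → E}
    (hu : ∀ t, HasDerivAt u (A t (u t)) t) (s : ℝ) : ∀ᶠ t in 𝓝 s, u t = Λ t s (u s) := by
  have hone : Λ s s = 1 := ContinuousLinearMap.ext (h.apply_self s)
  have hunit : ∀ᶠ t in 𝓝 s, IsUnit (Λ t s) :=
    (h.continuous_fst s).continuousAt.eventually
      (Units.isOpen.mem_nhds (by simp [hone]))
  obtain ⟨r, hr, hball⟩ := Metric.eventually_nhds_iff_ball.1 hunit
  set V : ℝ → E →L[ℝ] E := fun t => Ring.inverse (Λ t s) with hV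
  have hUV : ∀ t ∈ Metric.ball s r, ∀ ξ, Λ t s (V t ξ) = ξ := fun t ht ξ =>
    DFunLike.congr_fun (Ring.mul_inverse_cancel _ (hball t ht)) ξ
  have hVU : ∀ t ∈ Metric.ball s r, ∀ ξ, V t (Λ t s ξ) = ξ := fun t ht ξ =>
    DFunLike.congr_fun (Ring.inverse_mul_cancel _ (hball t ht)) ξ
  have hderiv : ∀ t ∈ Metric.ball s r, HasDerivAt (fun τ => V τ (u τ)) 0 t := by
    intro t ht
    have hVc : ContinuousAt V t := by
      obtain ⟨w, hw⟩ := hball t ht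
      have hinv := NormedRing.inverse_continuousAt w
      rw [hw] at hinv
      exact ContinuousAt.comp (f := fun τ => Λ τ s) hinv (h.continuous_fst s).continuousAt
    set ξ := V t (u t) with hξ
    have hdiff : HasDerivAt (fun τ => u τ - Λ τ s ξ) 0 t := by
      have := (hu t).sub (h.hasDerivAt s ξ t)
      rwa [hξ, hUV t ht, sub_self] at this
    have hzero : u t - Λ t s ξ = 0 := by rw [hξ, hUV t ht, sub_self]
    have hprod : HasDerivAt (fun τ => V τ (u τ - Λ τ s ξ)) (V t 0 + 0) t := by
      refine HasDerivAt.clm_apply_of_continuousAt hVc ?_ hdiff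
      simp only [hzero, map_zero]
      exact hasDerivAt_const t 0
    rw [map_zero, add_zero] at hprod
    refine (hprod.add_const ξ).congr_of_eventuallyEq ?_
    filter_upwards [Metric.isOpen_ball.mem_nhds ht] with τ hτ
    rw [map_sub, hVU τ hτ, sub_add_cancel]
  filter_upwards [Metric.ball_mem_nhds s hr] with t ht
  have hconst : V t (u t) = V s (u s) :=
    Metric.isOpen_ball.is_const_of_deriv_eq_zero (convex_ball s r).isPreconnected
      (fun τ hτ => (hderiv τ hτ).differentiableAt.differentiableWithinAt)
      (fun τ hτ => (hderiv τ hτ).deriv) ht (Metric.mem_ball_self hr)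
  have hVs : V s (u s) = u s := by simp [hV, hone]
  rw [← hVs, ← hconst, hUV t ht]

theorem eq_zero_of_apply_eq_zero [CompleteSpace E] (h : IsEvolutionFamily Λ A) {u : ℝ → E}
    (hu : ∀ t, HasDerivAt u (A t (u t)) t) {s : ℝ} (hs : u s = 0) (t : ℝ) : u t = 0 := by
  have hcont : Continuous u := continuous_iff_continuousAt.2 fun t => (hu t).continuousAt
  have hclopen : IsClopen {t | u t = 0} := by
    refine ⟨isClosed_eq hcont continuous_const, isOpen_iff_mem_nhds.2 fun τ hτ => ?_⟩
    filter_upwards [h.eventually_eq_apply hu τ] with r hr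
    rw [hr, show u τ = 0 from hτ, map_zero]
  exact (hclopen.eq_univ ⟨s, hs⟩).ge (mem_univ t)

theorem apply_apply [CompleteSpace E] (h : IsEvolutionFamily Λ A) (t s r : ℝ) (ξ : E) :
    Λ t s (Λ s r ξ) = Λ t r ξ := by
  refine sub_eq_zero.1 (h.eq_zero_of_apply_eq_zero
    (u := fun τ => Λ τ s (Λ s r ξ) - Λ τ r ξ) (s := s) (fun τ => ?_) ?_ t)
  · rw [map_sub]
    exact (h.hasDerivAt s _ τ).sub (h.hasDerivAt r ξ τ)
  · rw [h.apply_self, sub_self]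

theorem hasDerivAt_apply (h : IsEvolutionFamily Λ A) {c : ℝ → E} {c' : E} {t : ℝ}
    (hc : HasDerivAt c c' t) : HasDerivAt (fun τ => Λ τ t (c τ)) (A t (c t) + c') t := by
  have := HasDerivAt.clm_apply_of_continuousAt (h.continuous_fst t).continuousAt
    (h.hasDerivAt t (c t) t) hc
  rwa [h.apply_self, h.apply_self, add_comm] at this

/-- Variation of constants, forward in time. -/
theorem hasDerivAt_add_integral [CompleteSpace E] (h : IsEvolutionFamily Λ A) {f : ℝ → E}
    (hf : Continuous f) (t₀ : ℝ) (x₀ : E) (t : ℝ) :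
    HasDerivAt (fun τ => Λ τ t₀ x₀ + ∫ s in t₀..τ, Λ τ s (f s))
      (A t (Λ t t₀ x₀ + ∫ s in t₀..t, Λ t s (f s)) + f t) t := by
  have hc := h.continuous_apply hf t
  have hint : HasDerivAt (fun τ => Λ t t₀ x₀ + ∫ s in t₀..τ, Λ t s (f s)) (f t) t := by
    have := (hc.integral_hasStrictDerivAt t₀ t).hasDerivAt.const_add (Λ t t₀ x₀)
    rwa [h.apply_self] at this
  refine (h.hasDerivAt_apply hint).congr_of_eventuallyEq (Eventually.of_forall fun τ => ?_)
  simp only [map_add, h.apply_apply]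
  rw [← (Λ τ t).intervalIntegral_comp_comm (hc.intervalIntegrable _ _)]
  simp only [h.apply_apply]

/-- Variation of constants, backward from infinity. -/
theorem hasDerivAt_neg_integral_Ici [CompleteSpace E] (h : IsEvolutionFamily Λ A) {f : ℝ → E}
    (hf : Continuous f) {t : ℝ} (hint : IntegrableOn (fun s => Λ t s (f s)) (Ici t)) :
    HasDerivAt (fun τ => -∫ s in Ici τ, Λ τ s (f s))
      (A t (-∫ s in Ici t, Λ t s (f s)) + f t) t := by
  have hc := h.continuous_apply hf t
  have hint_all : ∀ τ, IntegrableOn (fun s => Λ t s (f s)) (Ici τ) := fun τ =>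
    ((hc.integrableOn_Icc (a := τ) (b := t)).union hint).mono_set fun s hs =>
      (le_total s t).imp (fun hst => ⟨hs, hst⟩) id
  have hderiv : HasDerivAt (fun τ => -∫ s in Ici τ, Λ t s (f s)) (f t) t := by
    have := ((hc.integral_hasStrictDerivAt t t).hasDerivAt).sub_const (∫ s in Ici t, Λ t s (f s))
    rw [h.apply_self] at this
    refine this.congr_of_eventuallyEq (Eventually.of_forall fun τ => ?_)
    dsimp only
    rw [← intervalIntegral.integral_Ici_sub_Ici' hint (hint_all τ)]
    abel
  refine (h.hasDerivAt_apply hderiv).congr_of_eventuallyEq (Eventually.of_forall fun τ => ?_)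
  dsimp only
  rw [map_neg, ← (Λ τ t).integral_comp_comm (hint_all τ)]
  simp only [h.apply_apply]

end IsEvolutionFamily

end Evolution

section Estimates

variable {E : Type*} [NormedAddCommGroup E] [NormedSpace ℝ E]

theorem norm_intervalIntegral_le_of_forward_dichotomy {Λ : ℝ → ℝ → E →L[ℝ] E} {f : ℝ → E}
    {K C α σ t₀ a b t : ℝ} (hK : 0 ≤ K) (hC : 0 ≤ C) (hασ : α < σ) (hab : a ≤ b) (hbt : b ≤ t)
    (hΛ : ∀ t s, s ≤ t → ‖Λ t s‖ ≤ K * Real.exp (α * (t - s)))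
    (hf : ∀ s ∈ Ioc a b, ‖f s‖ ≤ C * Real.exp (σ * (s - t₀))) :
    Real.exp (-σ * (t - t₀)) * ‖∫ s in a..b, Λ t s (f s)‖
      ≤ K * C / (σ - α) * Real.exp (-(σ - α) * (t - b)) := by
  set M := K * C * Real.exp (α * t - σ * t₀) with hM
  have hpt : ∀ s ∈ Ioc a b, ‖Λ t s (f s)‖ ≤ M * Real.exp ((σ - α) * s) := by
    intro s hs
    calc ‖Λ t s (f s)‖ ≤ (K * Real.exp (α * (t - s))) * (C * Real.exp (σ * (s - t₀))) :=
          (Λ t s).le_of_opNorm_le_of_le (hΛ t s (hs.2.trans hbt)) (hf s hs)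
      _ = M * Real.exp ((σ - α) * s) := by
          rw [hM, mul_mul_mul_comm, ← Real.exp_add, mul_assoc (K * C), ← Real.exp_add]
          ring_nf
  have hexp : IntegrableOn (fun s => M * Real.exp ((σ - α) * s)) (Iic b) :=
    (integrableOn_exp_mul_Iic (sub_pos.2 hασ) b).const_mul M
  have hnorm : ‖∫ s in a..b, Λ t s (f s)‖ ≤ M * (Real.exp ((σ - α) * b) / (σ - α)) := by
    rw [intervalIntegral.integral_of_le hab]
    calc ‖∫ s in Ioc a b, Λ t s (f s)‖ ≤ ∫ s in Ioc a b, M * Real.exp ((σ - α) * s) :=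
          norm_integral_le_of_norm_le (hexp.mono_set Ioc_subset_Iic_self)
            ((ae_restrict_iff' measurableSet_Ioc).2 (Eventually.of_forall hpt))
      _ ≤ ∫ s in Iic b, M * Real.exp ((σ - α) * s) :=
          setIntegral_mono_set hexp (Eventually.of_forall fun s => by positivity)
            Ioc_subset_Iic_self.eventuallyLE
      _ = M * (Real.exp ((σ - α) * b) / (σ - α)) := by
          rw [integral_const_mul, integral_exp_mul_Iic (sub_pos.2 hασ)]
  refine (mul_le_mul_of_nonneg_left hnorm (Real.exp_pos _).le).trans_eq ?_
  have hexponent : Real.exp (-(σ - α) * (t - b)) =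
      Real.exp (-σ * (t - t₀)) * Real.exp (α * t - σ * t₀) * Real.exp ((σ - α) * b) := by
    rw [← Real.exp_add, ← Real.exp_add]
    ring_nf
  rw [hexponent, hM]
  ring

theorem norm_apply_le_of_backward_dichotomy {Λ : ℝ → ℝ → E →L[ℝ] E} {f : ℝ → E}
    {K C β σ t₀ t s : ℝ} (hts : t ≤ s)
    (hΛ : ∀ t s, t ≤ s → ‖Λ t s‖ ≤ K * Real.exp (β * (t - s)))
    (hf : ‖f s‖ ≤ C * Real.exp (σ * (s - t₀))) :
    ‖Λ t s (f s)‖ ≤ K * C * Real.exp (β * t - σ * t₀) * Real.exp ((σ - β) * s) := by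
  refine ((Λ t s).le_of_opNorm_le_of_le (hΛ t s hts) hf).trans_eq ?_
  rw [mul_mul_mul_comm, ← Real.exp_add, mul_assoc (K * C), ← Real.exp_add]
  ring_nf

theorem integrableOn_exp_mul_Ici {a : ℝ} (ha : a < 0) (c : ℝ) :
    IntegrableOn (fun x => Real.exp (a * x)) (Ici c) := by
  rw [integrableOn_Ici_iff_integrableOn_Ioi]
  exact integrableOn_exp_mul_Ioi ha c

theorem integrableOn_Ici_of_backward_dichotomy {Λ : ℝ → ℝ → E →L[ℝ] E} {f : ℝ → E}
    {K C β σ t₀ t : ℝ} (hσβ : σ < β) (hc : Continuous fun s => Λ t s (f s))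
    (hΛ : ∀ t s, t ≤ s → ‖Λ t s‖ ≤ K * Real.exp (β * (t - s)))
    (hf : ∀ s, t ≤ s → ‖f s‖ ≤ C * Real.exp (σ * (s - t₀))) :
    IntegrableOn (fun s => Λ t s (f s)) (Ici t) := by
  have hexp : IntegrableOn
      (fun s => K * C * Real.exp (β * t - σ * t₀) * Real.exp ((σ - β) * s)) (Ici t) :=
    (integrableOn_exp_mul_Ici (sub_neg.2 hσβ) t).const_mul _
  exact hexp.mono' hc.aestronglyMeasurable ((ae_restrict_iff' measurableSet_Ici).2
    (Eventually.of_forall fun s hs => norm_apply_le_of_backward_dichotomy hs hΛ (hf s hs)))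

theorem norm_integral_Ici_le_of_backward_dichotomy {Λ : ℝ → ℝ → E →L[ℝ] E} {f : ℝ → E}
    {K C β σ t₀ t : ℝ} (hσβ : σ < β)
    (hΛ : ∀ t s, t ≤ s → ‖Λ t s‖ ≤ K * Real.exp (β * (t - s)))
    (hf : ∀ s, t ≤ s → ‖f s‖ ≤ C * Real.exp (σ * (s - t₀))) :
    Real.exp (-σ * (t - t₀)) * ‖∫ s in Ici t, Λ t s (f s)‖ ≤ K * C / (β - σ) := by
  set M := K * C * Real.exp (β * t - σ * t₀) with hM
  have hexp : IntegrableOn (fun s => M * Real.exp ((σ - β) * s)) (Ici t) :=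
    (integrableOn_exp_mul_Ici (sub_neg.2 hσβ) t).const_mul M
  have hnorm : ‖∫ s in Ici t, Λ t s (f s)‖ ≤ M * (-Real.exp ((σ - β) * t) / (σ - β)) := by
    refine (norm_integral_le_of_norm_le hexp ((ae_restrict_iff' measurableSet_Ici).2
      (Eventually.of_forall fun s hs =>
        norm_apply_le_of_backward_dichotomy hs hΛ (hf s hs)))).trans_eq ?_
    rw [integral_const_mul, integral_Ici_eq_integral_Ioi, integral_exp_mul_Ioi (sub_neg.2 hσβ)]
  refine (mul_le_mul_of_nonneg_left hnorm (Real.exp_pos _).le).trans_eq ?_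
  have hexponent : Real.exp (-σ * (t - t₀)) * Real.exp (β * t - σ * t₀) *
      Real.exp ((σ - β) * t) = 1 := by
    rw [← Real.exp_add, ← Real.exp_add, ← Real.exp_zero]
    ring_nf
  calc Real.exp (-σ * (t - t₀)) * (M * (-Real.exp ((σ - β) * t) / (σ - β)))
      = K * C * (Real.exp (-σ * (t - t₀)) * Real.exp (β * t - σ * t₀) *
          Real.exp ((σ - β) * t)) * (-1 / (σ - β)) := by rw [hM]; ring
    _ = K * C / (β - σ) := by
        rw [hexponent, ← neg_sub β σ, neg_div_neg_eq]
        ring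

/-- A bounded nonnegative function whose eventual bounds contract by a factor `θ < 1` tends to
zero. -/
theorem tendsto_zero_of_eventual_bound_contraction {w : ℝ → ℝ} {θ M : ℝ} (hw : ∀ t, 0 ≤ w t)
    (hθ0 : 0 ≤ θ) (hθ1 : θ < 1) (hM : ∀ᶠ t in atTop, w t ≤ M)
    (hstep : ∀ c, (∀ᶠ t in atTop, w t ≤ c) → ∀ c', θ * c < c' → ∀ᶠ t in atTop, w t ≤ c') :
    Tendsto w atTop (𝓝 0) := by
  set S := {c | ∀ᶠ t in atTop, w t ≤ c} with hS
  have hS0 : ∀ c ∈ S, 0 ≤ c := fun c hc => by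
    obtain ⟨t, ht⟩ := Eventually.exists hc
    exact (hw t).trans ht
  have hbdd : BddBelow S := ⟨0, hS0⟩
  have hle : sInf S ≤ 0 := by
    by_contra! hpos
    obtain ⟨c, hcS, hc⟩ := exists_lt_of_csInf_lt (s := S) ⟨M, hM⟩
      (show sInf S < (2 - θ) * sInf S by nlinarith)
    have hlt : θ * c < sInf S := by
      nlinarith [mul_le_mul_of_nonneg_left hc.le hθ0, mul_pos (pow_pos (sub_pos.2 hθ1) 2) hpos]
    obtain ⟨c', hc', hc'S⟩ := exists_between hlt
    exact hc'S.not_ge (csInf_le hbdd (hstep c hcS c' hc'))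
  refine tendsto_order.2 ⟨fun a ha => Eventually.of_forall fun t => ha.trans_le (hw t),
    fun a ha => ?_⟩
  obtain ⟨c, hcS, hc⟩ := exists_lt_of_csInf_lt (s := S) ⟨M, hM⟩ (hle.trans_lt ha)
  exact Eventually.mono hcS fun t ht => ht.trans_lt hc

end Estimates

theorem fixed_point_solves_ivp
    {X Y : Type*} [NormedAddCommGroup X] [NormedSpace ℝ X] [CompleteSpace X]
    [NormedAddCommGroup Y] [NormedSpace ℝ Y] [CompleteSpace Y]
    (ΛA : ℝ → ℝ → X →L[ℝ] X) (ΛB : ℝ → ℝ → Y →L[ℝ] Y)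
    (Aop : ℝ → X →L[ℝ] X) (Bop : ℝ → Y →L[ℝ] Y)
    (F : ℝ → X × Y → X) (G : ℝ → X × Y → Y)
    (K L α β σ t₀ : ℝ) (x₀ : X) (φ : ℝ → X × Y)
    (hK : 1 ≤ K) (hL : 0 < L) (hαβ : α < β)
    (hΛA : ∀ t s, s ≤ t → ‖ΛA t s‖ ≤ K * Real.exp (α * (t - s)))
    (hΛB : ∀ t s, t ≤ s → ‖ΛB t s‖ ≤ K * Real.exp (β * (t - s)))
    (hΛAc : Continuous fun p : ℝ × ℝ => ΛA p.1 p.2)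
    (hΛBc : Continuous fun p : ℝ × ℝ => ΛB p.1 p.2)
    (hΛAid : ∀ s ξ, ΛA s s ξ = ξ)
    (hΛBid : ∀ s ξ, ΛB s s ξ = ξ)
    (hΛAev : ∀ s ξ t, HasDerivAt (fun τ => ΛA τ s ξ) (Aop t (ΛA t s ξ)) t)
    (hΛBev : ∀ s ξ t, HasDerivAt (fun τ => ΛB τ s ξ) (Bop t (ΛB t s ξ)) t)
    (hFc : Continuous fun p : ℝ × (X × Y) => F p.1 p.2)
    (hGc : Continuous fun p : ℝ × (X × Y) => G p.1 p.2)
    (hF0 : ∀ t, F t 0 = 0) (hG0 : ∀ t, G t 0 = 0)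
    (hLip : ∀ t z₁ z₂, max ‖F t z₁ - F t z₂‖ ‖G t z₁ - G t z₂‖ ≤ L * ‖z₁ - z₂‖)
    (hgap : L < (β - α) / (2 * K))
    (hσ1 : α + K * L < σ) (hσ2 : σ < β - K * L)
    (hφc : ContinuousOn φ (Set.Ici t₀))
    (hφbdd : BddAbove ((fun s => Real.exp (-σ * (s - t₀)) * ‖φ s‖) '' Set.Ici t₀))
    (hfix : ∀ t, t₀ ≤ t →
      φ t = (ΛA t t₀ x₀ + ∫ s in t₀..t, ΛA t s (F s (φ s)),
              -∫ s in Set.Ici t, ΛB t s (G s (φ s)))) :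
    (φ t₀).1 = x₀ ∧
    (φ t₀).2 = -∫ s in Set.Ici t₀, ΛB t₀ s (G s (φ s)) ∧
    (∀ t, t₀ ≤ t →
      HasDerivWithinAt (fun τ => (φ τ).1)
        (Aop t ((φ t).1) + F t (φ t)) (Set.Ici t₀) t ∧
      HasDerivWithinAt (fun τ => (φ τ).2)
        (Bop t ((φ t).2) + G t (φ t)) (Set.Ici t₀) t) ∧
    Filter.Tendsto (fun t => Real.exp (-σ * (t - t₀)) * ‖(φ t).2‖)
      Filter.atTop (nhds 0) := by
  have hK0 : 0 < K := by linarith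
  have hKL : 0 < K * L := mul_pos hK0 hL
  have hασ : α < σ := by linarith
  have hσβ : σ < β := by linarith
  have hA : IsEvolutionFamily ΛA Aop := ⟨hΛAc, hΛAid, hΛAev⟩
  have hB : IsEvolutionFamily ΛB Bop := ⟨hΛBc, hΛBid, hΛBev⟩
  obtain ⟨ψ, hψc, hψ⟩ : ∃ ψ : ℝ → X × Y, Continuous ψ ∧ ∀ s, t₀ ≤ s → ψ s = φ s :=
    ⟨fun s => φ (max s t₀),
      hφc.comp_continuous (continuous_id.max continuous_const) fun s => le_max_right s t₀,
      fun s hs => by simp only [max_eq_left hs]⟩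
  set f : ℝ → X := fun s => F s (ψ s) with hf
  set g : ℝ → Y := fun s => G s (ψ s) with hg
  have hfc : Continuous f := hFc.comp (continuous_id.prodMk hψc)
  have hgc : Continuous g := hGc.comp (continuous_id.prodMk hψc)
  have hfst : ∀ t, t₀ ≤ t → (φ t).1 = ΛA t t₀ x₀ + ∫ s in t₀..t, ΛA t s (f s) := by
    intro t ht
    rw [hfix t ht]
    refine congrArg _ (intervalIntegral.integral_congr fun s hs => ?_)
    rw [uIcc_of_le ht] at hs
    simp only [hf, hψ s hs.1]
  have hsnd : ∀ t, t₀ ≤ t → (φ t).2 = -∫ s in Ici t, ΛB t s (g s) := by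
    intro t ht
    rw [hfix t ht]
    refine congrArg _ (setIntegral_congr_fun measurableSet_Ici fun s hs => ?_)
    simp only [hg, hψ s (ht.trans hs)]
  set w : ℝ → ℝ := fun s => Real.exp (-σ * (s - t₀)) * ‖φ s‖ with hw
  have hw0 : ∀ s, 0 ≤ w s := fun s => by positivity
  obtain ⟨M, hM⟩ : ∃ M, ∀ s, t₀ ≤ s → w s ≤ M :=
    hφbdd.imp fun M hM s hs => hM ⟨s, hs, rfl⟩
  have hM0 : 0 ≤ M := (hw0 t₀).trans (hM t₀ le_rfl)
  have hψ_le : ∀ c s, t₀ ≤ s → w s ≤ c → L * ‖ψ s‖ ≤ L * c * Real.exp (σ * (s - t₀)) := by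
    intro c s hs hc
    have hws : w s * Real.exp (σ * (s - t₀)) = ‖ψ s‖ := by
      rw [hψ s hs, hw, mul_right_comm, ← Real.exp_add, neg_mul, neg_add_cancel, Real.exp_zero,
        one_mul]
    rw [← hws, mul_assoc L c]
    exact mul_le_mul_of_nonneg_left
      (mul_le_mul_of_nonneg_right hc (Real.exp_pos _).le) hL.le
  have hf_le : ∀ c s, t₀ ≤ s → w s ≤ c → ‖f s‖ ≤ L * c * Real.exp (σ * (s - t₀)) := by
    intro c s hs hc
    have := (le_max_left _ _).trans (hLip s (ψ s) 0)
    rw [hF0, sub_zero, sub_zero] at this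
    exact this.trans (hψ_le c s hs hc)
  have hg_le : ∀ c s, t₀ ≤ s → w s ≤ c → ‖g s‖ ≤ L * c * Real.exp (σ * (s - t₀)) := by
    intro c s hs hc
    have := (le_max_right _ _).trans (hLip s (ψ s) 0)
    rw [hG0, sub_zero, sub_zero] at this
    exact this.trans (hψ_le c s hs hc)
  have hdecay : Tendsto w atTop (𝓝 0) := by
    have hθA : K * L / (σ - α) < 1 := (div_lt_one (by linarith)).2 (by linarith)
    have hθB : K * L / (β - σ) < 1 := (div_lt_one (by linarith)).2 (by linarith)
    refine tendsto_zero_of_eventual_bound_contraction hw0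
      ((div_nonneg hKL.le (sub_nonneg.2 hασ.le)).trans (le_max_left _ (K * L / (β - σ))))
      (max_lt hθA hθB) ((eventually_ge_atTop t₀).mono hM) fun c hc c' hcc' => ?_
    obtain ⟨T, hT, hwT⟩ : ∃ T, t₀ ≤ T ∧ ∀ s, T ≤ s → w s ≤ c := by
      obtain ⟨T, hT⟩ := eventually_atTop.1 hc
      exact ⟨max T t₀, le_max_right _ _, fun s hs => hT s ((le_max_left _ _).trans hs)⟩
    have hc0 : 0 ≤ c := (hw0 T).trans (hwT T le_rfl)
    have hexp : ∀ r C : ℝ, Tendsto (fun t => C * Real.exp (-(σ - α) * (t - r))) atTop (𝓝 0) := by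
      intro r C
      rw [← mul_zero C]
      exact ((Real.tendsto_exp_atBot.comp
        ((tendsto_atTop_add_const_right _ (-r) tendsto_id).const_mul_atTop_of_neg
          (by linarith))).const_mul C)
    have hsmall := (hexp t₀ (K * ‖x₀‖)).add (hexp T (K * (L * M) / (σ - α)))
    rw [add_zero] at hsmall
    filter_upwards [hsmall.eventually_lt_const (sub_pos.2 hcc'), eventually_ge_atTop T]
      with t ht hTt
    have htt₀ := hT.trans hTt
    rw [hw]
    dsimp only
    rw [Prod.norm_def, mul_max_of_nonneg _ _ (Real.exp_pos _).le]
    refine max_le ?_ ?_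
    · have hcont := hA.continuous_apply hfc t
      rw [hfst t htt₀, ← intervalIntegral.integral_add_adjacent_intervals
        (hcont.intervalIntegrable t₀ T) (hcont.intervalIntegrable T t)]
      have hinit : Real.exp (-σ * (t - t₀)) * ‖ΛA t t₀ x₀‖
          ≤ K * ‖x₀‖ * Real.exp (-(σ - α) * (t - t₀)) := by
        calc Real.exp (-σ * (t - t₀)) * ‖ΛA t t₀ x₀‖
            ≤ Real.exp (-σ * (t - t₀)) * (K * Real.exp (α * (t - t₀)) * ‖x₀‖) := by
              gcongr
              exact (ΛA t t₀).le_of_opNorm_le (hΛA t t₀ htt₀) x₀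
          _ = K * ‖x₀‖ * (Real.exp (-σ * (t - t₀)) * Real.exp (α * (t - t₀))) := by ring
          _ = K * ‖x₀‖ * Real.exp (-(σ - α) * (t - t₀)) := by
              rw [← Real.exp_add]
              ring_nf
      have hpast := norm_intervalIntegral_le_of_forward_dichotomy hK0.le (mul_nonneg hL.le hM0)
        hασ hT hTt hΛA fun s hs => hf_le M s hs.1.le (hM s hs.1.le)
      have hrecent := norm_intervalIntegral_le_of_forward_dichotomy hK0.le (mul_nonneg hL.le hc0)
        hασ hTt le_rfl hΛA fun s hs => hf_le c s (hT.trans hs.1.le) (hwT s hs.1.le)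
      rw [sub_self, mul_zero, Real.exp_zero, mul_one] at hrecent
      have hθ : K * (L * c) / (σ - α) ≤ max (K * L / (σ - α)) (K * L / (β - σ)) * c := by
        rw [← mul_assoc, mul_div_right_comm]
        exact mul_le_mul_of_nonneg_right (le_max_left _ _) hc0
      calc _ ≤ Real.exp (-σ * (t - t₀)) * (‖ΛA t t₀ x₀‖ + (‖∫ s in t₀..T, ΛA t s (f s)‖
              + ‖∫ s in T..t, ΛA t s (f s)‖)) := by
            gcongr
            exact (norm_add_le _ _).trans (by gcongr; exact norm_add_le _ _)
        _ ≤ c' := by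
            rw [mul_add, mul_add]
            linarith
    · rw [hsnd t htt₀, norm_neg]
      refine (norm_integral_Ici_le_of_backward_dichotomy hσβ hΛB fun s hs =>
        hg_le c s (htt₀.trans hs) (hwT s (hTt.trans hs))).trans (le_trans ?_ hcc'.le)
      rw [← mul_assoc, mul_div_right_comm]
      exact mul_le_mul_of_nonneg_right (le_max_right _ _) hc0
  refine ⟨?_, ?_, fun t ht => ⟨?_, ?_⟩, ?_⟩
  · rw [hfst t₀ le_rfl, intervalIntegral.integral_same, add_zero, hΛAid]
  · rw [hfix t₀ le_rfl]
  · have hderiv := hA.hasDerivAt_add_integral hfc t₀ x₀ t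
    rw [← hfst t ht, show f t = F t (φ t) by simp only [hf, hψ t ht]] at hderiv
    exact hderiv.hasDerivWithinAt.congr (fun τ hτ => hfst τ hτ) (hfst t ht)
  · have hderiv := hB.hasDerivAt_neg_integral_Ici hgc
      (integrableOn_Ici_of_backward_dichotomy hσβ (hB.continuous_apply hgc t) hΛB
        fun s hs => hg_le M s (ht.trans hs) (hM s (ht.trans hs)))
    rw [← hsnd t ht, show g t = G t (φ t) by simp only [hg, hψ t ht]] at hderiv
    exact hderiv.hasDerivWithinAt.congr (fun τ hτ => hsnd τ hτ) (hsnd t ht)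
  · refine squeeze_zero (fun t => by positivity) (fun t => ?_) hdecay
    exact mul_le_mul_of_nonneg_left (norm_snd_le (φ t)) (Real.exp_pos _).le
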